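/- Let G be a finite simple very well-covered graph. Then the following assertions are equivalent: (i) Ψ(G) is a greedoid on V(G); (ii) G has a uniquely restricted maximum matching; (iii) G has a maximum matching M such that G contains no M-alternating cycle; (iv) G has a maximum matching M such that G contains no M-alternating cycle of length four; (v) for every maximum matching M of G, G contains no M-alternating cycle; (vi) for every maximum matching M of G, G contains no M-alternating cycle of length four; (vii) every maximum matching of G is uniquely restricted. -/

import Mathlib

open Classical

variable {V : Type*} [Fintype V] [DecidableEq V]

/-- `S` is a stable (independent) set of vertices in `G`. -/
def IsStable (G : SimpleGraph V) (S : Finset V) : Prop :=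
  ∀ ⦃x⦄, x ∈ S → ∀ ⦃y⦄, y ∈ S → ¬G.Adj x y

/-- The open neighborhood `N(S)`: vertices outside `S` having a neighbor in `S`. -/
noncomputable def nbhd (G : SimpleGraph V) (S : Finset V) : Finset V :=
  Finset.univ.filter fun v => v ∉ S ∧ ∃ u ∈ S, G.Adj u v

/-- The closed neighborhood `N[S] = S ∪ N(S)`. -/
noncomputable def closedNbhd (G : SimpleGraph V) (S : Finset V) : Finset V :=
  S ∪ nbhd G S

/-- The stability (independence) number of the subgraph of `G` induced by `A`. -/
noncomputable def alphaOn (G : SimpleGraph V) (A : Finset V) : ℕ :=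
  sSup {n | ∃ S ⊆ A, IsStable G S ∧ S.card = n}

/-- The stability (independence) number `α(G)`. -/
noncomputable def alpha (G : SimpleGraph V) : ℕ :=
  alphaOn G Finset.univ

/-- `S` is a maximum stable set of the subgraph of `G` induced by `N[S]`. -/
def IsLocalMaxStable (G : SimpleGraph V) (S : Finset V) : Prop :=
  IsStable G S ∧ S.card = alphaOn G (closedNbhd G S)

/-- `Ψ(G)`: the family of all local maximum stable sets of `G`. -/
def Psi (G : SimpleGraph V) : Set (Finset V) :=
  {S | IsLocalMaxStable G S}

/-- A matching of `G`: a set of pairwise disjoint edges of `G`. -/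
def IsGMatching (G : SimpleGraph V) (M : Finset (Sym2 V)) : Prop :=
  (∀ e ∈ M, e ∈ G.edgeSet) ∧
    ∀ e ∈ M, ∀ f ∈ M, e ≠ f → ∀ v : V, v ∈ e → v ∉ f

/-- A matching of `G` all of whose edges have both endpoints inside `A`,
i.e. a matching of the subgraph of `G` induced by `A`. -/
def IsGMatchingOn (G : SimpleGraph V) (A : Finset V) (M : Finset (Sym2 V)) : Prop :=
  IsGMatching G M ∧ ∀ e ∈ M, ∀ v : V, v ∈ e → v ∈ A

/-- The matching number of the subgraph of `G` induced by `A`. -/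
noncomputable def muOn (G : SimpleGraph V) (A : Finset V) : ℕ :=
  sSup {n | ∃ M, IsGMatchingOn G A M ∧ M.card = n}

/-- The matching number `μ(G)`. -/
noncomputable def mu (G : SimpleGraph V) : ℕ :=
  muOn G Finset.univ

/-- A maximum matching of `G`. -/
def IsMaximumGMatching (G : SimpleGraph V) (M : Finset (Sym2 V)) : Prop :=
  IsGMatching G M ∧ M.card = mu G

/-- The matching `M` saturates the vertex `v`. -/
def MSaturates (M : Finset (Sym2 V)) (v : V) : Prop :=
  ∃ e ∈ M, v ∈ e

/-- A perfect matching of `G`: a matching saturating every vertex. -/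
def IsPerfectGMatching (G : SimpleGraph V) (M : Finset (Sym2 V)) : Prop :=
  IsGMatching G M ∧ ∀ v : V, MSaturates M v

/-- The set of vertices saturated by `M`. -/
noncomputable def msupp (M : Finset (Sym2 V)) : Finset V :=
  Finset.univ.filter fun v => ∃ e ∈ M, v ∈ e

/-- `M` is a uniquely restricted matching: it is the unique perfect matching of
the subgraph of `G` induced by the set of vertices saturated by `M`. -/
def UniquelyRestricted (G : SimpleGraph V) (M : Finset (Sym2 V)) : Prop :=
  IsGMatching G M ∧
    ∀ M' : Finset (Sym2 V), IsGMatchingOn G (msupp M) M' →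
      (∀ v ∈ msupp M, MSaturates M' v) → M' = M

/-- Accessibility property of a set system. -/
def AccessibleFam (F : Set (Finset V)) : Prop :=
  ∀ X ∈ F, X ≠ ∅ → ∃ x ∈ X, X.erase x ∈ F

/-- Exchange property of a set system. -/
def ExchangeFam (F : Set (Finset V)) : Prop :=
  ∀ X ∈ F, ∀ Y ∈ F, X.card = Y.card + 1 → ∃ x ∈ X, x ∉ Y ∧ insert x Y ∈ F

/-- A greedoid: a nonempty set system satisfying accessibility and exchange. -/
def IsGreedoidFam (F : Set (Finset V)) : Prop :=
  F.Nonempty ∧ AccessibleFam F ∧ ExchangeFam F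

/-- A maximal stable set. -/
def IsMaximalStable (G : SimpleGraph V) (S : Finset V) : Prop :=
  IsStable G S ∧ ∀ T, IsStable G T → S ⊆ T → S = T

/-- `G` is well-covered: all maximal stable sets have the same cardinality. -/
def WellCovered (G : SimpleGraph V) : Prop :=
  ∀ S T, IsMaximalStable G S → IsMaximalStable G T → S.card = T.card

/-- `G` is very well-covered: well-covered, no isolated vertices, `|V| = 2α(G)`. -/
def VeryWellCovered (G : SimpleGraph V) : Prop :=
  WellCovered G ∧ (∀ v : V, ∃ u, G.Adj v u) ∧ Fintype.card V = 2 * alpha G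

/-- The subgraph of `G` induced by `A` is a König-Egerváry graph. -/
def KonigEgervaryOn (G : SimpleGraph V) (A : Finset V) : Prop :=
  alphaOn G A + muOn G A = A.card

/-- `G` is a König-Egerváry graph: `α(G) + μ(G) = |V(G)|`. -/
def KonigEgervary (G : SimpleGraph V) : Prop :=
  alpha G + mu G = Fintype.card V

/-- The cycle `c` is alternating with respect to `M`: of every two incident
edges of `c` exactly one belongs to `M`. -/
def IsAlternatingCycle (G : SimpleGraph V) (M : Finset (Sym2 V)) {v : V}
    (c : G.Walk v v) : Prop :=
  c.IsCycle ∧ ∀ e ∈ c.edges, ∀ f ∈ c.edges, e ≠ f →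
    (∃ u : V, u ∈ e ∧ u ∈ f) → (e ∈ M ↔ f ∉ M)

/-- `G` contains an `M`-alternating cycle. -/
def HasAlternatingCycle (G : SimpleGraph V) (M : Finset (Sym2 V)) : Prop :=
  ∃ (v : V) (c : G.Walk v v), IsAlternatingCycle G M c

/-- The cycle `c` is chordless: the subgraph induced by its vertices has no
edges other than the cycle edges. -/
def ChordlessCycle (G : SimpleGraph V) {v : V} (c : G.Walk v v) : Prop :=
  ∀ x ∈ c.support, ∀ y ∈ c.support, G.Adj x y → s(x, y) ∈ c.edges

/-- `p` sends every vertex to its partner in some perfect matching of `G`. -/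
structure IsPartner (G : SimpleGraph V) (p : V → V) : Prop where
  invol : ∀ v, p (p v) = v
  adj : ∀ v, G.Adj v (p v)

/-- The perfect matching described by a partner function. -/
noncomputable def partnerMatching (p : V → V) : Finset (Sym2 V) :=
  Finset.univ.image fun v => s(v, p v)

theorem card_le_alphaOn {G : SimpleGraph V} {A S : Finset V} (hSA : S ⊆ A) (hS : IsStable G S) :
    S.card ≤ alphaOn G A := by
  refine le_csSup ⟨A.card, ?_⟩ ⟨S, hSA, hS, rfl⟩
  rintro n ⟨T, hT, -, rfl⟩
  exact Finset.card_le_card hT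

theorem exists_card_eq_alphaOn (G : SimpleGraph V) (A : Finset V) :
    ∃ S ⊆ A, IsStable G S ∧ S.card = alphaOn G A := by
  refine Nat.sSup_mem (s := {n | ∃ S ⊆ A, IsStable G S ∧ S.card = n}) ?_ ⟨A.card, ?_⟩
  · exact ⟨0, ∅, by simp, fun x hx => by simp at hx, rfl⟩
  · rintro n ⟨T, hT, -, rfl⟩
    exact Finset.card_le_card hT

theorem IsStable.exists_isMaximalStable {G : SimpleGraph V} {S : Finset V} (hS : IsStable G S) :
    ∃ T, S ⊆ T ∧ IsMaximalStable G T := by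
  obtain ⟨T, hST, hT⟩ := (Set.toFinite {T : Finset V | IsStable G T}).exists_le_maximal hS
  exact ⟨T, hST, hT.prop, fun U hU hTU => le_antisymm hTU (hT.le_of_ge hU hTU)⟩

theorem WellCovered.card_eq_alpha {G : SimpleGraph V} (hG : WellCovered G) {T : Finset V}
    (hT : IsMaximalStable G T) : T.card = alpha G := by
  obtain ⟨S, -, hS, hSc⟩ := exists_card_eq_alphaOn G Finset.univ
  refine (hG T S hT ⟨hS, fun U hU hSU => ?_⟩).trans hSc
  exact Finset.eq_of_subset_of_card_le hSU (hSc ▸ card_le_alphaOn (Finset.subset_univ U) hU)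

theorem mem_nbhd {G : SimpleGraph V} {S : Finset V} {v : V} :
    v ∈ nbhd G S ↔ v ∉ S ∧ ∃ u ∈ S, G.Adj u v := by
  simp [nbhd]

theorem WellCovered.card_le_card_nbhd {G : SimpleGraph V} (hG : WellCovered G)
    (hiso : ∀ v : V, ∃ u, G.Adj v u) (A : Finset V) (hA : IsStable G A) :
    A.card ≤ (nbhd G A).card := by
  induction A using Finset.strongInduction with
  | H A ih =>
    obtain rfl | ⟨a, ha⟩ := A.eq_empty_or_nonempty
    · simp
    obtain ⟨v, hav⟩ := hiso a
    obtain ⟨T, hvT, hT⟩ := IsStable.exists_isMaximalStable (G := G) (S := {v}) (by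
      intro x hx y hy
      simp_all)
    have haT : a ∉ T := fun h => hT.1 h (hvT (Finset.mem_singleton_self v)) hav
    have hlt : A ∩ T ⊂ A := by
      refine Finset.ssubset_iff_subset_ne.2 ⟨Finset.inter_subset_left, fun h => haT ?_⟩
      rw [← h] at ha
      exact (Finset.mem_inter.1 ha).2
    have h1 := ih _ hlt fun x hx y hy =>
      hA (Finset.mem_inter.1 hx).1 (Finset.mem_inter.1 hy).1
    have hsub : nbhd G (A ∩ T) ⊆ nbhd G A \ T := by
      intro x hx
      obtain ⟨-, u, hu, hux⟩ := mem_nbhd.1 hx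
      obtain ⟨huA, huT⟩ := Finset.mem_inter.1 hu
      exact Finset.mem_sdiff.2
        ⟨mem_nbhd.2 ⟨fun h => hA huA h hux, u, huA, hux⟩, fun h => hT.1 huT h hux⟩
    have hst : IsStable G ((T \ nbhd G A) ∪ A) := by
      intro x hx y hy hxy
      simp only [Finset.mem_union, Finset.mem_sdiff, mem_nbhd, not_and, not_exists] at hx hy
      rcases hx with ⟨hxT, hx⟩ | hx <;> rcases hy with ⟨hyT, hy⟩ | hy
      · exact hT.1 hxT hyT hxy
      · exact hx (fun h => hA h hy hxy) y hy hxy.symm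
      · exact hy (fun h => hA hx h hxy) x hx hxy
      · exact hA hx hy hxy
    have h2 : ((T \ nbhd G A) ∪ A).card ≤ T.card := by
      rw [hG.card_eq_alpha hT]
      exact card_le_alphaOn (Finset.subset_univ _) hst
    have h3 : ((T \ nbhd G A) ∪ (A \ T)).card ≤ T.card :=
      (Finset.card_le_card (Finset.union_subset_union_right Finset.sdiff_subset)).trans h2
    rw [Finset.card_union_of_disjoint (by
      rw [Finset.disjoint_left]
      intro x hx hx'
      exact (Finset.mem_sdiff.1 hx').2 (Finset.mem_sdiff.1 hx).1)] at h3
    have h4 := Finset.card_le_card hsub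
    have h5 := Finset.card_sdiff_add_card_inter T (nbhd G A)
    have h6 := Finset.card_sdiff_add_card_inter A T
    have h7 := Finset.card_sdiff_add_card_inter (nbhd G A) T
    rw [Finset.inter_comm] at h7
    omega

theorem VeryWellCovered.exists_isPartner {G : SimpleGraph V} (hG : VeryWellCovered G) :
    ∃ p, IsPartner G p := by
  obtain ⟨hwc, hiso, hcard⟩ := hG
  obtain ⟨S, -, hS, hSc⟩ := exists_card_eq_alphaOn G Finset.univ
  obtain ⟨f, hf, hfn⟩ := (Finset.all_card_le_biUnion_card_iff_exists_injective
    (fun s : S => nbhd G {s.1})).1 (by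
      intro A
      have h := hwc.card_le_card_nbhd hiso (A.map (Function.Embedding.subtype _)) (by
        intro x hx y hy
        simp only [Finset.mem_map, Function.Embedding.subtype_apply] at hx hy
        obtain ⟨x, -, rfl⟩ := hx
        obtain ⟨y, -, rfl⟩ := hy
        exact hS x.2 y.2)
      rw [Finset.card_map] at h
      refine h.trans (Finset.card_le_card fun v hv => ?_)
      obtain ⟨-, u, hu, huv⟩ := mem_nbhd.1 hv
      simp only [Finset.mem_map, Function.Embedding.subtype_apply] at hu
      obtain ⟨u, hu, rfl⟩ := hu
      refine Finset.mem_biUnion.2 ⟨u, hu, mem_nbhd.2 ⟨?_, u, by simp, huv⟩⟩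
      simpa using huv.ne')
  have hadj : ∀ s : S, G.Adj s.1 (f s) := by
    intro s
    obtain ⟨-, u, hu, huv⟩ := mem_nbhd.1 (hfn s)
    rwa [Finset.mem_singleton.1 hu] at huv
  have hfS : ∀ s : S, f s ∉ S := fun s h => hS s.2 h (hadj s)
  have himg : Finset.univ.image f = Sᶜ := by
    refine Finset.eq_of_subset_of_card_le ?_ ?_
    · intro v hv
      obtain ⟨s, -, rfl⟩ := Finset.mem_image.1 hv
      exact Finset.mem_compl.2 (hfS s)
    · rw [Finset.card_image_of_injective _ hf, Finset.card_compl, Finset.card_univ,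
        Fintype.card_coe, hSc, hcard, alpha]
      omega
  have hsurj : ∀ v, v ∉ S → ∃ s, f s = v := by
    intro v hv
    have h : v ∈ Finset.univ.image f := by
      rw [himg]
      exact Finset.mem_compl.2 hv
    simpa using h
  choose g hg using hsurj
  have hgf : ∀ s, g (f s) (hfS s) = s := fun s => hf (hg _ (hfS s))
  refine ⟨fun v => if h : v ∈ S then f ⟨v, h⟩ else g v h, fun v => ?_, fun v => ?_⟩
  · by_cases h : v ∈ S
    · simp [h, hfS, hgf]
    · simp [h, hg]
  · by_cases h : v ∈ S
    · simpa [h] using hadj ⟨v, h⟩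
    · have := hadj (g v h)
      rw [hg v h] at this
      simpa [h] using this.symm

theorem IsPartner.injective {G : SimpleGraph V} {p : V → V} (hp : IsPartner G p) :
    Function.Injective p :=
  Function.Involutive.injective hp.invol

theorem IsPartner.mem_or_mem {G : SimpleGraph V} (hG : VeryWellCovered G) {p : V → V}
    (hp : IsPartner G p) {T : Finset V} (hT : IsMaximalStable G T) (v : V) : v ∈ T ∨ p v ∈ T := by
  have hdisj : Disjoint T (T.image p) := by
    rw [Finset.disjoint_left]
    intro x hx hx'
    obtain ⟨y, hy, rfl⟩ := Finset.mem_image.1 hx'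
    exact hT.1 hy hx (hp.adj y)
  have huniv : T ∪ T.image p = Finset.univ := by
    rw [← Finset.card_eq_iff_eq_univ, Finset.card_union_of_disjoint hdisj,
      Finset.card_image_of_injective _ hp.injective, hG.1.card_eq_alpha hT, hG.2.2]
    omega
  have hv := huniv.symm ▸ Finset.mem_univ v
  rcases Finset.mem_union.1 hv with h | h
  · exact Or.inl h
  · obtain ⟨y, hy, rfl⟩ := Finset.mem_image.1 h
    exact Or.inr (by rwa [hp.invol])

theorem IsPartner.adj_of_adj {G : SimpleGraph V} (hG : VeryWellCovered G) {p : V → V}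
    (hp : IsPartner G p) {x u w : V} (hu : G.Adj u x) (hw : G.Adj w (p x)) : G.Adj u w := by
  by_contra huw
  obtain ⟨T, hsub, hT⟩ := IsStable.exists_isMaximalStable (G := G) (S := {u, w}) (by
    intro a ha b hb hab
    simp only [Finset.mem_insert, Finset.mem_singleton] at ha hb
    rcases ha with rfl | rfl <;> rcases hb with rfl | rfl
    · exact hab.ne rfl
    · exact huw hab
    · exact huw hab.symm
    · exact hab.ne rfl)
  rcases hp.mem_or_mem hG hT x with h | h
  · exact hT.1 (hsub (by simp)) h hu
  · exact hT.1 (hsub (by simp)) h hw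

theorem IsPartner.mem_Psi_iff {G : SimpleGraph V} (hG : VeryWellCovered G) {p : V → V}
    (hp : IsPartner G p) {S : Finset V} :
    S ∈ Psi G ↔ (∀ x ∈ S, p x ∉ S) ∧ ∀ x ∈ S, ∀ z, G.Adj x (p z) → z ∈ S := by
  constructor
  · rintro ⟨hS, hSc⟩
    refine ⟨fun x hx hpx => hS hx hpx (hp.adj x), fun x hx z hxz => ?_⟩
    by_contra hz
    obtain ⟨T, hsub, hT⟩ := IsStable.exists_isMaximalStable (G := G) (S := {p z}) (by
      intro a ha b hb
      simp_all)
    let t : V → V := fun v => if v ∈ T then v else p v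
    have htT : ∀ v, t v ∈ T := by
      intro v
      by_cases h : v ∈ T
      · simp [t, h]
      · simpa [t, h] using (hp.mem_or_mem hG hT v).resolve_left h
    have ht : ∀ v, t v = v ∨ t v = p v := by
      intro v
      by_cases h : v ∈ T <;> simp [t, h]
    have hzS : p z ∉ S := fun h => hS hx h hxz
    have hinj : Set.InjOn t S := by
      intro a ha b hb hab
      rcases ht a with h | h <;> rcases ht b with h' | h' <;> rw [h, h'] at hab
      · exact hab
      · exact (hS hb (hab ▸ ha) (hp.adj b)).elim
      · exact (hS ha (hab ▸ hb) (hp.adj a)).elim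
      · exact hp.injective hab
    have hnot : p z ∉ S.image t := by
      intro h
      obtain ⟨a, ha, h⟩ := Finset.mem_image.1 h
      rcases ht a with h' | h' <;> rw [h'] at h
      · exact hzS (h ▸ ha)
      · exact hz (hp.injective h ▸ ha)
    have hle : (insert (p z) (S.image t)).card ≤ alphaOn G (closedNbhd G S) := by
      refine card_le_alphaOn ?_ ?_
      · intro v hv
        rcases Finset.mem_insert.1 hv with rfl | hv
        · exact Finset.mem_union_right _ (mem_nbhd.2 ⟨hzS, x, hx, hxz⟩)
        · obtain ⟨a, ha, rfl⟩ := Finset.mem_image.1 hv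
          rcases ht a with h | h <;> rw [h]
          · exact Finset.mem_union_left _ ha
          · exact Finset.mem_union_right _
              (mem_nbhd.2 ⟨fun h => hS ha h (hp.adj a), a, ha, hp.adj a⟩)
      · have : insert (p z) (S.image t) ⊆ T := by
          intro v hv
          rcases Finset.mem_insert.1 hv with rfl | hv
          · exact hsub (Finset.mem_singleton_self _)
          · obtain ⟨a, -, rfl⟩ := Finset.mem_image.1 hv
            exact htT a
        exact fun a ha b hb => hT.1 (this ha) (this hb)
    rw [Finset.card_insert_of_notMem hnot, Finset.card_image_of_injOn hinj, ← hSc] at hle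
    omega
  · rintro ⟨hfree, hclosed⟩
    have hS : IsStable G S := by
      intro x hx y hy hxy
      exact hfree y hy (hclosed x hx (p y) (by rwa [hp.invol]))
    refine ⟨hS, le_antisymm (card_le_alphaOn Finset.subset_union_left hS) ?_⟩
    obtain ⟨U, hU, hUs, hUc⟩ := exists_card_eq_alphaOn G (closedNbhd G S)
    rw [← hUc]
    refine Finset.card_le_card_of_injOn (fun v => if v ∈ S then v else p v) ?_ ?_
    · intro v hv
      by_cases h : v ∈ S
      · simp [h]
      · have hv' := (Finset.mem_union.1 (hU hv)).resolve_left h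
        obtain ⟨-, u, hu, huv⟩ := mem_nbhd.1 hv'
        simpa [h] using hclosed u hu (p v) (by rwa [hp.invol])
    · intro a ha b hb hab
      by_cases h : a ∈ S <;> by_cases h' : b ∈ S <;> simp only [h, h', if_true, if_false] at hab
      · exact hab
      · exact (hUs hb ha (hab ▸ hp.adj b)).elim
      · exact (hUs ha hb (hab ▸ hp.adj a)).elim
      · exact hp.injective hab

/-- The relation `fun x z => G.Adj x (p z)` is antisymmetric. -/
def PartnerAntisymm (G : SimpleGraph V) (p : V → V) : Prop :=
  ∀ a z, G.Adj a (p z) → G.Adj z (p a) → a = z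

theorem IsPartner.adj_trans {G : SimpleGraph V} (hG : VeryWellCovered G) {p : V → V}
    (hp : IsPartner G p) {x y z : V} (hxy : G.Adj x (p y)) (hyz : G.Adj y (p z)) :
    G.Adj x (p z) :=
  hp.adj_of_adj hG hxy (by rw [hp.invol]; exact hyz.symm)

theorem IsPartner.partnerAntisymm_of_accessible {G : SimpleGraph V} (hG : VeryWellCovered G)
    {p : V → V} (hp : IsPartner G p) (hacc : AccessibleFam (Psi G)) : PartnerAntisymm G p := by
  intro a z haz hza
  by_contra hne
  have key : ∀ X : Finset V, X ∈ Psi G → a ∉ X := by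
    intro X
    induction X using Finset.strongInduction with
    | H X ih =>
      intro hX haX
      obtain ⟨x, hx, hXx⟩ := hacc X hX (Finset.ne_empty_of_mem haX)
      have hax : a ∉ X.erase x := ih _ (Finset.erase_ssubset hx) hXx
      have hzX := ((hp.mem_Psi_iff hG).1 hX).2 a haX z haz
      obtain rfl : a = x := by
        by_contra h
        exact hax (Finset.mem_erase.2 ⟨h, haX⟩)
      exact hax (((hp.mem_Psi_iff hG).1 hXx).2 z (Finset.mem_erase.2 ⟨Ne.symm hne, hzX⟩) a hza)
  refine key (Finset.univ.filter fun w => G.Adj a (p w)) ((hp.mem_Psi_iff hG).2 ⟨?_, ?_⟩) ?_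
  · intro x hx hpx
    simp only [Finset.mem_filter, Finset.mem_univ, true_and, hp.invol] at hx hpx
    exact (hp.adj_of_adj hG hpx hx).ne rfl
  · intro x hx w hxw
    simp only [Finset.mem_filter, Finset.mem_univ, true_and] at hx ⊢
    exact hp.adj_trans hG hx hxw
  · simpa using hp.adj a

theorem exists_maximal_of_antisymm {r : V → V → Prop}
    (htrans : ∀ x y z, r x y → r y z → r x z) (hanti : ∀ x y, r x y → r y x → x = y)
    {Z : Finset V} (hZ : Z.Nonempty) : ∃ x ∈ Z, ∀ w ∈ Z, r x w → w = x := by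
  let r' : V → V → Prop := fun x y => r y x ∧ x ≠ y
  have : IsTrans V r' := ⟨fun x y z hxy hyz => ⟨htrans _ _ _ hyz.1 hxy.1, by
    rintro rfl
    exact hxy.2 (hanti _ _ hyz.1 hxy.1)⟩⟩
  have : Std.Irrefl r' := ⟨fun x hx => hx.2 rfl⟩
  obtain ⟨x, hx, hmin⟩ := (Finite.wellFounded_of_trans_of_irrefl r').has_min (Z : Set V) hZ
  refine ⟨x, hx, fun w hw hxw => ?_⟩
  by_contra hne
  exact hmin w hw ⟨hxw, hne⟩

theorem IsPartner.isGreedoidFam_Psi {G : SimpleGraph V} (hG : VeryWellCovered G) {p : V → V}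
    (hp : IsPartner G p) (hanti : PartnerAntisymm G p) : IsGreedoidFam (Psi G) := by
  refine ⟨⟨∅, (hp.mem_Psi_iff hG).2 (by simp)⟩, ?_, ?_⟩
  · intro X hX hne
    obtain ⟨hfree, hclosed⟩ := (hp.mem_Psi_iff hG).1 hX
    obtain ⟨x, hx, hmin⟩ := exists_maximal_of_antisymm (r := fun x z => G.Adj z (p x))
      (fun x y z hxy hyz => hp.adj_trans hG hyz hxy) (fun x y hxy hyx => hanti x y hyx hxy)
      (Finset.nonempty_iff_ne_empty.2 hne)
    refine ⟨x, hx, (hp.mem_Psi_iff hG).2 ⟨?_, ?_⟩⟩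
    · intro y hy hpy
      exact hfree y (Finset.mem_of_mem_erase hy) (Finset.mem_of_mem_erase hpy)
    · intro y hy z hyz
      obtain ⟨hyx, hyX⟩ := Finset.mem_erase.1 hy
      refine Finset.mem_erase.2 ⟨?_, hclosed y hyX z hyz⟩
      rintro rfl
      exact hyx (hmin y hyX hyz)
  · intro X hX Y hY hcard
    obtain ⟨hXf, hXc⟩ := (hp.mem_Psi_iff hG).1 hX
    obtain ⟨hYf, hYc⟩ := (hp.mem_Psi_iff hG).1 hY
    have hZ : (X.filter fun x => x ∉ Y ∧ p x ∉ Y).Nonempty := by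
      by_contra hempty
      rw [Finset.not_nonempty_iff_eq_empty, Finset.filter_eq_empty_iff] at hempty
      have hle : X.card ≤ Y.card := by
        refine Finset.card_le_card_of_injOn (fun v => if v ∈ Y then v else p v) ?_ ?_
        · intro v hv
          by_cases h : v ∈ Y
          · simp [h]
          · have := hempty hv
            simp only [h, not_false_eq_true, true_and, not_not] at this
            simpa [h] using this
        · intro a ha b hb hab
          by_cases h : a ∈ Y <;> by_cases h' : b ∈ Y <;>
            simp only [h, h', if_true, if_false] at hab
          · exact hab
          · exact (hXf b hb (hab ▸ ha)).elim
          · exact (hXf a ha (hab ▸ hb)).elim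
          · exact hp.injective hab
      omega
    obtain ⟨x, hx, hmax⟩ := exists_maximal_of_antisymm (r := fun x z => G.Adj x (p z))
      (fun x y z hxy hyz => hp.adj_trans hG hxy hyz) hanti hZ
    obtain ⟨hxX, hxY, hpxY⟩ := Finset.mem_filter.1 hx
    refine ⟨x, hxX, hxY, (hp.mem_Psi_iff hG).2 ⟨?_, ?_⟩⟩
    · intro y hy hpy
      rcases Finset.mem_insert.1 hy with rfl | hy <;> rcases Finset.mem_insert.1 hpy with h | hpy
      · exact (hp.adj y).ne h.symm
      · exact hpxY hpy
      · exact hpxY (by rwa [← h, hp.invol])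
      · exact hYf y hy hpy
    · intro y hy w hyw
      rcases Finset.mem_insert.1 hy with rfl | hy
      · by_contra hw
        rw [Finset.mem_insert, not_or] at hw
        have hpw : p w ∉ Y := fun h => hpxY (hYc (p w) h (p y) (by rw [hp.invol]; exact hyw.symm))
        exact hw.1 (hmax w (Finset.mem_filter.2 ⟨hXc y hxX w hyw, hw.2, hpw⟩) hyw)
      · exact Finset.mem_insert_of_mem (hYc y hy w hyw)

theorem IsPartner.eq_of_partnerAntisymm {G : SimpleGraph V} (hG : VeryWellCovered G)
    {p q : V → V} (hp : IsPartner G p) (hq : IsPartner G q) (hanti : PartnerAntisymm G p) :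
    q = p := by
  funext v
  obtain ⟨P, hP⟩ : ∃ P : Equiv.Perm V, ∀ w, P w = p w :=
    ⟨Function.Involutive.toPerm p hp.invol, fun _ => rfl⟩
  obtain ⟨Q, hQ⟩ : ∃ Q : Equiv.Perm V, ∀ w, Q w = q w :=
    ⟨Function.Involutive.toPerm q hq.invol, fun _ => rfl⟩
  have key : ∀ k : ℕ, G.Adj v (q (((P * Q) ^ k) v)) := by
    intro k
    induction k with
    | zero => exact hq.adj v
    | succ k ih =>
      rw [pow_succ', Equiv.Perm.mul_apply, Equiv.Perm.mul_apply, hP, hQ]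
      refine hp.adj_of_adj hG ih ?_
      exact (hq.adj (p (q (((P * Q) ^ k) v)))).symm
  have hpos := orderOf_pos (P * Q)
  have hpow : (P * Q) ^ (2 * orderOf (P * Q) - 2) = (Q * P) ^ 2 := by
    have h : (P * Q) ^ 2 * (Q * P) ^ 2 = 1 := by
      ext w
      simp [pow_two, Equiv.Perm.mul_apply, hP, hQ, hp.invol, hq.invol]
    refine mul_left_cancel (a := (P * Q) ^ 2) ?_
    rw [h, ← pow_add, show 2 + (2 * orderOf (P * Q) - 2) = orderOf (P * Q) * 2 by omega, pow_mul,
      pow_orderOf_eq_one, one_pow]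
  have h := key (2 * orderOf (P * Q) - 2)
  rw [hpow] at h
  have h' : G.Adj v (p (q (p v))) := by
    simpa [pow_two, Equiv.Perm.mul_apply, hP, hQ, hq.invol] using h
  have := hanti v (q (p v)) h' (hq.adj (p v)).symm
  rw [← hq.invol (p v), ← this]

theorem IsPartner.partnerAntisymm_of_unique {G : SimpleGraph V} {p : V → V}
    (hp : IsPartner G p) (huniq : ∀ q, IsPartner G q → q = p) : PartnerAntisymm G p := by
  intro a z haz hza
  by_contra hne
  let s : Equiv.Perm V := Equiv.swap (p a) (p z)
  have hq : IsPartner G fun v => s (p (s v)) := by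
    refine ⟨fun v => by simp [s, hp.invol], fun v => ?_⟩
    have h1 : a ≠ p a := (hp.adj a).ne
    have h2 : z ≠ p z := (hp.adj z).ne
    have h3 : p a ≠ p z := fun h => hne (hp.injective h)
    have h4 := haz.ne
    have h5 := hza.ne
    by_cases hva : v = p a
    · subst hva
      simpa [s, hp.invol, Equiv.swap_apply_of_ne_of_ne h5 h2] using hza.symm
    by_cases hvz : v = p z
    · subst hvz
      simpa [s, hp.invol, Equiv.swap_apply_of_ne_of_ne h1 h4] using haz.symm
    by_cases hva' : v = a
    · subst hva'
      simpa [s, Equiv.swap_apply_of_ne_of_ne h1 h4] using haz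
    by_cases hvz' : v = z
    · subst hvz'
      simpa [s, Equiv.swap_apply_of_ne_of_ne h5 h2] using hza
    simpa [s, Equiv.swap_apply_of_ne_of_ne hva hvz,
      Equiv.swap_apply_of_ne_of_ne (hp.injective.ne hva') (hp.injective.ne hvz')] using hp.adj v
  have h := congrFun (huniq _ hq) a
  have : s (p (s a)) = p z := by
    simp [s, Equiv.swap_apply_of_ne_of_ne (hp.adj a).ne haz.ne]
  exact hne (hp.injective (h.symm.trans this))

theorem IsPartner.mk_mem_partnerMatching {G : SimpleGraph V} {p : V → V} (hp : IsPartner G p)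
    {v w : V} : s(v, w) ∈ partnerMatching p ↔ w = p v := by
  simp only [partnerMatching, Finset.mem_image, Finset.mem_univ, true_and, Sym2.eq_iff]
  constructor
  · rintro ⟨u, ⟨rfl, rfl⟩ | ⟨rfl, rfl⟩⟩
    · rfl
    · exact (hp.invol u).symm
  · rintro rfl
    exact ⟨v, Or.inl ⟨rfl, rfl⟩⟩

theorem IsPartner.isPerfectGMatching {G : SimpleGraph V} {p : V → V} (hp : IsPartner G p) :
    IsPerfectGMatching G (partnerMatching p) := by
  refine ⟨⟨?_, ?_⟩, fun v => ⟨s(v, p v), hp.mk_mem_partnerMatching.2 rfl, by simp⟩⟩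
  · intro e
    induction e with
    | h x y =>
      rintro h
      rw [hp.mk_mem_partnerMatching.1 h]
      exact hp.adj x
  · intro e he f hf hne v hve hvf
    obtain ⟨x, rfl⟩ := Sym2.mem_iff_exists.1 hve
    obtain ⟨y, rfl⟩ := Sym2.mem_iff_exists.1 hvf
    rw [hp.mk_mem_partnerMatching] at he hf
    exact hne (by rw [he, hf])

theorem IsPerfectGMatching.exists_isPartner {G : SimpleGraph V} {M : Finset (Sym2 V)}
    (hM : IsPerfectGMatching G M) : ∃ p, IsPartner G p ∧ M = partnerMatching p := by
  have hex : ∀ v, ∃ w, s(v, w) ∈ M := by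
    intro v
    obtain ⟨e, he, hv⟩ := hM.2 v
    obtain ⟨w, rfl⟩ := Sym2.mem_iff_exists.1 hv
    exact ⟨w, he⟩
  choose p hpM using hex
  have huniq : ∀ v w, s(v, w) ∈ M → w = p v := by
    intro v w hw
    by_contra hne
    exact hM.1.2 _ hw _ (hpM v) (fun h => hne (Sym2.congr_right.1 h)) v (by simp) (by simp)
  have hp : IsPartner G p :=
    ⟨fun v => (huniq (p v) v (Sym2.eq_swap ▸ hpM v)).symm, fun v => hM.1.1 _ (hpM v)⟩
  refine ⟨p, hp, ?_⟩
  ext e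
  induction e with
  | h x y =>
    rw [hp.mk_mem_partnerMatching]
    exact ⟨huniq x y, fun h => h ▸ hpM x⟩

theorem mem_msupp {M : Finset (Sym2 V)} {v : V} : v ∈ msupp M ↔ MSaturates M v := by
  simp [msupp, MSaturates]

theorem IsGMatching.card_msupp {G : SimpleGraph V} {M : Finset (Sym2 V)} (hM : IsGMatching G M) :
    (msupp M).card = 2 * M.card := by
  have h : msupp M = M.biUnion Sym2.toFinset := by
    ext v
    simp [msupp]
  rw [h, Finset.card_biUnion, Finset.sum_const_nat (m := 2), mul_comm]
  · intro e he
    exact Sym2.card_toFinset_of_not_isDiag e (G.not_isDiag_of_mem_edgeSet (hM.1 e he))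
  · intro e he f hf hne
    refine Finset.disjoint_left.2 fun v hv hv' => ?_
    exact hM.2 e he f hf hne v (Sym2.mem_toFinset.1 hv) (Sym2.mem_toFinset.1 hv')

theorem IsPerfectGMatching.msupp_eq_univ {G : SimpleGraph V} {M : Finset (Sym2 V)}
    (hM : IsPerfectGMatching G M) : msupp M = Finset.univ :=
  Finset.eq_univ_iff_forall.2 fun v => mem_msupp.2 (hM.2 v)

theorem IsPartner.two_mul_mu {G : SimpleGraph V} {p : V → V} (hp : IsPartner G p) :
    2 * mu G = Fintype.card V := by
  have hcard := hp.isPerfectGMatching.1.card_msupp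
  rw [hp.isPerfectGMatching.msupp_eq_univ, Finset.card_univ] at hcard
  have hbound : ∀ n ∈ {n | ∃ M, IsGMatchingOn G Finset.univ M ∧ M.card = n},
      n ≤ (partnerMatching p).card := by
    rintro n ⟨M, hM, rfl⟩
    have h1 := hM.1.card_msupp
    have h2 := Finset.card_le_univ (msupp M)
    omega
  have : mu G = (partnerMatching p).card :=
    IsGreatest.csSup_eq ⟨⟨_, ⟨hp.isPerfectGMatching.1, by simp⟩, rfl⟩, hbound⟩
  rw [this, hcard]

theorem IsPartner.isMaximumGMatching_iff {G : SimpleGraph V} {p : V → V} (hp : IsPartner G p)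
    {M : Finset (Sym2 V)} : IsMaximumGMatching G M ↔ IsPerfectGMatching G M := by
  have hmu := hp.two_mul_mu
  constructor
  · rintro ⟨hM, hc⟩
    refine ⟨hM, fun v => mem_msupp.1 ?_⟩
    have huniv : msupp M = Finset.univ := by
      rw [← Finset.card_eq_iff_eq_univ, hM.card_msupp, hc, hmu]
    exact huniv ▸ Finset.mem_univ v
  · intro hM
    refine ⟨hM.1, ?_⟩
    have := hM.1.card_msupp
    rw [hM.msupp_eq_univ, Finset.card_univ] at this
    omega

theorem IsPartner.uniquelyRestricted_iff {G : SimpleGraph V} {p : V → V} (hp : IsPartner G p) :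
    UniquelyRestricted G (partnerMatching p) ↔ ∀ q, IsPartner G q → q = p := by
  have hM := hp.isPerfectGMatching
  rw [UniquelyRestricted, hM.msupp_eq_univ]
  constructor
  · rintro ⟨-, h⟩ q hq
    have heq := h _ ⟨hq.isPerfectGMatching.1, by simp⟩ fun v _ => hq.isPerfectGMatching.2 v
    funext v
    rw [← hp.mk_mem_partnerMatching, ← heq, hq.mk_mem_partnerMatching]
  · refine fun h => ⟨hM.1, fun M' hM' hs => ?_⟩
    obtain ⟨q, hq, rfl⟩ :=
      IsPerfectGMatching.exists_isPartner ⟨hM'.1, fun v => hs v (Finset.mem_univ v)⟩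
    rw [h q hq]

theorem IsPartner.not_unique_of_hasAlternatingCycle {G : SimpleGraph V} {p : V → V}
    (hp : IsPartner G p) (h : HasAlternatingCycle G (partnerMatching p)) :
    ∃ q, IsPartner G q ∧ q ≠ p := by
  obtain ⟨a, c, hc, halt⟩ := h
  have htwo : ∀ v ∈ c.support, ∃ x y, x ≠ y ∧ s(v, x) ∈ c.edges ∧ s(v, y) ∈ c.edges := by
    intro v hv
    obtain ⟨x, y, hxy, hset⟩ := Set.ncard_eq_two.1 (hc.ncard_neighborSet_toSubgraph_eq_two hv)
    refine ⟨x, y, hxy, ?_, ?_⟩ <;>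
      simp [← SimpleGraph.Walk.adj_toSubgraph_iff_mem_edges,
        ← SimpleGraph.Subgraph.mem_neighborSet, hset]
  have hex : ∀ v ∈ c.support, ∃ w, s(v, w) ∈ c.edges ∧ w ≠ p v := by
    intro v hv
    obtain ⟨x, y, hxy, hx, hy⟩ := htwo v hv
    by_cases hxp : x = p v
    · exact ⟨y, hy, fun h => hxy (hxp.trans h.symm)⟩
    · exact ⟨x, hx, hxp⟩
  choose! r hre hrp using hex
  have huniq : ∀ v ∈ c.support, ∀ w, s(v, w) ∈ c.edges → w ≠ p v → w = r v := by
    intro v hv w hw hwp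
    by_contra hne
    have := halt _ hw _ (hre v hv) (fun h => hne (Sym2.congr_right.1 h)) ⟨v, by simp, by simp⟩
    rw [hp.mk_mem_partnerMatching, hp.mk_mem_partnerMatching] at this
    exact hwp (this.2 (hrp v hv))
  have hrs : ∀ v ∈ c.support, r v ∈ c.support :=
    fun v hv => c.snd_mem_support_of_mem_edges (hre v hv)
  have hrr : ∀ v ∈ c.support, r (r v) = v := by
    intro v hv
    refine (huniq (r v) (hrs v hv) v (Sym2.eq_swap ▸ hre v hv) fun h => hrp v hv ?_).symm
    rw [← hp.invol (r v), ← h]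
  have hps : ∀ v ∈ c.support, p v ∈ c.support := by
    intro v hv
    by_contra hpv
    obtain ⟨x, y, hxy, hx, hy⟩ := htwo v hv
    have hx' := huniq v hv x hx fun h => hpv (h ▸ c.snd_mem_support_of_mem_edges hx)
    have hy' := huniq v hv y hy fun h => hpv (h ▸ c.snd_mem_support_of_mem_edges hy)
    exact hxy (hx'.trans hy'.symm)
  refine ⟨fun v => if v ∈ c.support then r v else p v, ⟨fun v => ?_, fun v => ?_⟩, fun h => ?_⟩
  · by_cases hv : v ∈ c.support
    · simp [hv, hrs, hrr]
    · have : p v ∉ c.support := fun h => hv (hp.invol v ▸ hps _ h)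
      simp [hv, this, hp.invol]
  · by_cases hv : v ∈ c.support
    · simpa [hv] using c.adj_of_mem_edges (hre v hv)
    · simpa [hv] using hp.adj v
  · have := congrFun h a
    simp only [c.start_mem_support, if_true] at this
    exact hrp a c.start_mem_support this

theorem IsPartner.exists_four_cycle {G : SimpleGraph V} {p : V → V} (hp : IsPartner G p)
    (h : ¬PartnerAntisymm G p) :
    ∃ (v : V) (c : G.Walk v v), IsAlternatingCycle G (partnerMatching p) c ∧ c.length = 4 := by
  simp only [PartnerAntisymm, not_forall] at h
  obtain ⟨a, z, haz, hza, hne⟩ := h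
  have h1 := (hp.adj a).ne
  have h2 := (hp.adj z).ne
  have h3 : p a ≠ p z := fun h => hne (hp.injective h)
  have h4 := haz.ne
  have h5 := hza.ne
  refine ⟨a, .cons (hp.adj a) (.cons hza.symm (.cons (hp.adj z) (.cons haz.symm .nil))),
    ⟨?_, ?_⟩, rfl⟩
  · rw [SimpleGraph.Walk.cons_isCycle_iff]
    simp [SimpleGraph.Walk.cons_isPath_iff, h1.symm, h2, h3, h4.symm, h5.symm, Ne.symm hne, h1, h4,
      hne]
  · have m1 : s(a, p a) ∈ partnerMatching p := hp.mk_mem_partnerMatching.2 rfl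
    have m2 : s(p a, z) ∉ partnerMatching p := by
      rw [hp.mk_mem_partnerMatching, hp.invol]
      exact Ne.symm hne
    have m3 : s(z, p z) ∈ partnerMatching p := hp.mk_mem_partnerMatching.2 rfl
    have m4 : s(p z, a) ∉ partnerMatching p := by
      rw [hp.mk_mem_partnerMatching, hp.invol]
      exact hne
    intro e he f hf hef ⟨u, hue, huf⟩
    simp only [SimpleGraph.Walk.edges_cons, SimpleGraph.Walk.edges_nil, List.mem_cons,
      List.not_mem_nil, or_false] at he hf
    rcases he with rfl | rfl | rfl | rfl <;> rcases hf with rfl | rfl | rfl | rfl <;>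
      first
      | exact (hef rfl).elim
      | (simp only [m1, m2, m3, m4, not_true_eq_false, not_false_eq_true]; done)
      | (simp only [Sym2.mem_iff] at hue huf
         rcases hue with rfl | rfl <;> grind)

/-- For a very well-covered graph `G` the seven assertions are
equivalent. -/
theorem vwc_greedoid_tfae (G : SimpleGraph V) (hG : VeryWellCovered G) :
    List.TFAE
      [ IsGreedoidFam (Psi G),
        ∃ M : Finset (Sym2 V), IsMaximumGMatching G M ∧ UniquelyRestricted G M,
        ∃ M : Finset (Sym2 V), IsMaximumGMatching G M ∧ ¬HasAlternatingCycle G M,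
        ∃ M : Finset (Sym2 V), IsMaximumGMatching G M ∧
          ¬∃ (v : V) (c : G.Walk v v), IsAlternatingCycle G M c ∧ c.length = 4,
        ∀ M : Finset (Sym2 V), IsMaximumGMatching G M → ¬HasAlternatingCycle G M,
        ∀ M : Finset (Sym2 V), IsMaximumGMatching G M →
          ¬∃ (v : V) (c : G.Walk v v), IsAlternatingCycle G M c ∧ c.length = 4,
        ∀ M : Finset (Sym2 V), IsMaximumGMatching G M → UniquelyRestricted G M ] := by
  obtain ⟨p, hp⟩ := hG.exists_isPartner
  have hmax : ∀ M, IsMaximumGMatching G M ↔ ∃ q, IsPartner G q ∧ M = partnerMatching q := by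
    intro M
    rw [hp.isMaximumGMatching_iff]
    refine ⟨IsPerfectGMatching.exists_isPartner, ?_⟩
    rintro ⟨q, hq, rfl⟩
    exact hq.isPerfectGMatching
  have hmaxq : ∀ q, IsPartner G q → IsMaximumGMatching G (partnerMatching q) :=
    fun q hq => (hmax _).2 ⟨q, hq, rfl⟩
  have hcycle : ∀ q, IsPartner G q → PartnerAntisymm G q →
      ¬HasAlternatingCycle G (partnerMatching q) := by
    intro q hq hanti hcyc
    obtain ⟨q', hq', hne⟩ := hq.not_unique_of_hasAlternatingCycle hcyc
    exact hne (hq.eq_of_partnerAntisymm hG hq' hanti)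
  tfae_have 1 → 7 := by
    intro h M hM
    obtain ⟨q, hq, rfl⟩ := (hmax M).1 hM
    have hanti := hq.partnerAntisymm_of_accessible hG h.2.1
    exact hq.uniquelyRestricted_iff.2 fun q' hq' => hq.eq_of_partnerAntisymm hG hq' hanti
  tfae_have 7 → 5 := by
    intro h M hM
    obtain ⟨q, hq, rfl⟩ := (hmax M).1 hM
    exact hcycle q hq (hq.partnerAntisymm_of_unique (hq.uniquelyRestricted_iff.1 (h _ hM)))
  tfae_have 5 → 6 := fun h M hM ⟨v, c, hc, _⟩ => h M hM ⟨v, c, hc⟩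
  tfae_have 6 → 4 := fun h => ⟨_, hmaxq p hp, h _ (hmaxq p hp)⟩
  tfae_have 4 → 2 := by
    rintro ⟨M, hM, h⟩
    obtain ⟨q, hq, rfl⟩ := (hmax M).1 hM
    have hanti : PartnerAntisymm G q := by
      by_contra hn
      exact h (hq.exists_four_cycle hn)
    exact ⟨_, hM, hq.uniquelyRestricted_iff.2 fun q' hq' => hq.eq_of_partnerAntisymm hG hq' hanti⟩
  tfae_have 2 → 3 := by
    rintro ⟨M, hM, h⟩
    obtain ⟨q, hq, rfl⟩ := (hmax M).1 hM
    exact ⟨_, hM, hcycle q hq (hq.partnerAntisymm_of_unique (hq.uniquelyRestricted_iff.1 h))⟩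
  tfae_have 3 → 1 := by
    rintro ⟨M, hM, h⟩
    obtain ⟨q, hq, rfl⟩ := (hmax M).1 hM
    refine hq.isGreedoidFam_Psi hG (by_contra fun hn => h ?_)
    obtain ⟨v, c, hc, -⟩ := hq.exists_four_cycle hn
    exact ⟨v, c, hc⟩
  tfae_finish
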